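/- Let m > 1 be an integer, let Ω ⊂ ℝ^{2m} be open and connected, and let φ be a smooth function on Ω with Δ^m φ = 0, φ ≤ 0 on Ω, and φ not identically zero. Then the zero set S_0 := { x ∈ Ω : φ(x) = 0 } is a closed, nowhere dense subset of Ω whose Hausdorff dimension is at most 2m−1. -/

import Mathlib

open MeasureTheory Metric Filter Set
open scoped ENNReal Topology

/-- The Euclidean Laplacian of `f : ℝ^n → ℝ` (trace of the Hessian, computed as the sum of
second directional derivatives along the standard orthonormal basis). -/
noncomputable def lap {n : ℕ} (f : EuclideanSpace ℝ (Fin n) → ℝ) :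
    EuclideanSpace ℝ (Fin n) → ℝ :=
  fun x => ∑ i : Fin n,
    fderiv ℝ (fun y => fderiv ℝ f y (EuclideanSpace.single i 1)) x (EuclideanSpace.single i 1)

/-- The `i`-th partial derivative. -/
noncomputable def partialDeriv {n : ℕ} (i : Fin n) (f : EuclideanSpace ℝ (Fin n) → ℝ) :
    EuclideanSpace ℝ (Fin n) → ℝ :=
  fun x => fderiv ℝ f x (EuclideanSpace.single i 1)

/-- The iterated partial derivative along a list of coordinates, the head being applied first. -/
noncomputable def iterPartialDeriv {n : ℕ} :
    List (Fin n) → (EuclideanSpace ℝ (Fin n) → ℝ) → EuclideanSpace ℝ (Fin n) → ℝ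
  | [], f => f
  | i :: l, f => iterPartialDeriv l (partialDeriv i f)

section PartialDerivatives

variable {n : ℕ} {Ω : Set (EuclideanSpace ℝ (Fin n))} {f g : EuclideanSpace ℝ (Fin n) → ℝ}

theorem lap_eq_sum_partialDeriv (f : EuclideanSpace ℝ (Fin n) → ℝ) :
    lap f = fun x => ∑ i, partialDeriv i (partialDeriv i f) x := rfl

theorem ContDiffOn.partialDeriv (hΩ : IsOpen Ω) (hf : ContDiffOn ℝ (⊤ : ℕ∞) f Ω) (i : Fin n) :
    ContDiffOn ℝ (⊤ : ℕ∞) (partialDeriv i f) Ω :=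
  (hf.fderiv_of_isOpen hΩ (by simp)).clm_apply contDiffOn_const

theorem ContDiffOn.iterPartialDeriv (hΩ : IsOpen Ω) (l : List (Fin n))
    (hf : ContDiffOn ℝ (⊤ : ℕ∞) f Ω) : ContDiffOn ℝ (⊤ : ℕ∞) (iterPartialDeriv l f) Ω := by
  induction l generalizing f with
  | nil => exact hf
  | cons i l ih => exact ih (hf.partialDeriv hΩ i)

theorem ContDiffOn.lap (hΩ : IsOpen Ω) (hf : ContDiffOn ℝ (⊤ : ℕ∞) f Ω) :
    ContDiffOn ℝ (⊤ : ℕ∞) (lap f) Ω :=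
  ContDiffOn.sum fun i _ => (hf.partialDeriv hΩ i).partialDeriv hΩ i

theorem ContDiffOn.iterate_lap (hΩ : IsOpen Ω) (k : ℕ) (hf : ContDiffOn ℝ (⊤ : ℕ∞) f Ω) :
    ContDiffOn ℝ (⊤ : ℕ∞) (_root_.lap^[k] f) Ω := by
  induction k generalizing f with
  | zero => exact hf
  | succ k ih => exact ih (hf.lap hΩ)

theorem Set.EqOn.partialDeriv (hΩ : IsOpen Ω) (h : EqOn f g Ω) (i : Fin n) :
    EqOn (partialDeriv i f) (partialDeriv i g) Ω := fun x hx => by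
  have : f =ᶠ[𝓝 x] g := Filter.eventuallyEq_of_mem (hΩ.mem_nhds hx) h
  simp only [_root_.partialDeriv, this.fderiv_eq]

theorem Set.EqOn.iterPartialDeriv (hΩ : IsOpen Ω) (l : List (Fin n)) (h : EqOn f g Ω) :
    EqOn (iterPartialDeriv l f) (iterPartialDeriv l g) Ω := by
  induction l generalizing f g with
  | nil => exact h
  | cons i l ih => exact ih (h.partialDeriv hΩ i)

theorem Set.EqOn.iterate_lap (hΩ : IsOpen Ω) (k : ℕ) (h : EqOn f g Ω) :
    EqOn (lap^[k] f) (lap^[k] g) Ω := by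
  induction k generalizing f g with
  | zero => exact h
  | succ k ih =>
    refine ih fun x hx => ?_
    simp only [lap_eq_sum_partialDeriv]
    exact Finset.sum_congr rfl fun i _ => ((h.partialDeriv hΩ i).partialDeriv hΩ i) hx

theorem iterPartialDeriv_sum (hΩ : IsOpen Ω) {ι : Type*} (s : Finset ι) (l : List (Fin n))
    {F : ι → EuclideanSpace ℝ (Fin n) → ℝ} (hF : ∀ j ∈ s, ContDiffOn ℝ (⊤ : ℕ∞) (F j) Ω) :
    EqOn (iterPartialDeriv l fun x => ∑ j ∈ s, F j x)
      (fun x => ∑ j ∈ s, iterPartialDeriv l (F j) x) Ω := by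
  induction l generalizing F with
  | nil => exact fun x _ => rfl
  | cons i l ih =>
    have h : EqOn (partialDeriv i fun x => ∑ j ∈ s, F j x)
        (fun x => ∑ j ∈ s, partialDeriv i (F j) x) Ω := fun x hx => by
      simp only [partialDeriv]
      rw [fderiv_fun_sum fun j hj =>
        ((hF j hj).contDiffAt (hΩ.mem_nhds hx)).differentiableAt (by simp)]
      simp
    exact (h.iterPartialDeriv hΩ l).trans (ih fun j hj => (hF j hj).partialDeriv hΩ i)

theorem iterate_lap_eq_zero_of_flat (hΩ : IsOpen Ω) {x : EuclideanSpace ℝ (Fin n)} (hx : x ∈ Ω)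
    (k : ℕ) (hf : ContDiffOn ℝ (⊤ : ℕ∞) f Ω) (h : ∀ l, iterPartialDeriv l f x = 0) :
    lap^[k] f x = 0 := by
  induction k generalizing f with
  | zero => exact h []
  | succ k ih =>
    refine ih (hf.lap hΩ) fun l => ?_
    rw [lap_eq_sum_partialDeriv, iterPartialDeriv_sum hΩ _ _
      (fun i _ => (hf.partialDeriv hΩ i).partialDeriv hΩ i) hx]
    exact Finset.sum_eq_zero fun i _ => h (i :: i :: l)

theorem exists_iterPartialDeriv_eq_zero_fderiv_ne_zero {x : EuclideanSpace ℝ (Fin n)}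
    (hfx : f x = 0) {l : List (Fin n)} (hl : iterPartialDeriv l f x ≠ 0) :
    ∃ l', iterPartialDeriv l' f x = 0 ∧ fderiv ℝ (iterPartialDeriv l' f) x ≠ 0 := by
  induction l generalizing f with
  | nil => exact absurd hfx hl
  | cons i l ih =>
    by_cases h : partialDeriv i f x = 0
    · obtain ⟨l', h'⟩ := ih h hl
      exact ⟨i :: l', h'⟩
    · exact ⟨[], hfx, fun h0 => h (by
        simp only [iterPartialDeriv] at h0
        simp [partialDeriv, h0])⟩

end PartialDerivatives

section HausdorffDimension

variable {E : Type*} [NormedAddCommGroup E] [NormedSpace ℝ E] [FiniteDimensional ℝ E]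

/-- Near a point where the derivative of `g` does not vanish, the zero set of `g` has Hausdorff
dimension at most `finrank ℝ E - 1`. -/
theorem HasStrictFDerivAt.exists_nhds_dimH_le {g : E → ℝ} {L : E →L[ℝ] ℝ} {p : E}
    (hg : HasStrictFDerivAt g L p) (hL : L ≠ 0) :
    ∃ t ∈ 𝓝 p, dimH (t ∩ {x | g x = 0}) ≤ ((Module.finrank ℝ E - 1 : ℕ) : ℝ≥0∞) := by
  obtain ⟨v, hv⟩ : ∃ v, L v = 1 := by
    obtain ⟨w, hw⟩ : ∃ w, L w ≠ 0 := by
      by_contra! h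
      exact hL (ContinuousLinearMap.ext h)
    exact ⟨(L w)⁻¹ • w, by simp [hw]⟩
  set P : E → L.ker := fun y => ⟨y - L y • v, by simp [hv]⟩ with hP
  have hc : (0 : ℝ) < 1 / (2 * (‖v‖ + 1)) := by positivity
  have hs := hg.isLittleO.def hc
  obtain ⟨t, ht, hts⟩ := (Filter.eventually_iff_exists_mem.1 (by rwa [nhds_prod_eq] at hs))
  obtain ⟨t₁, ht₁, t₂, ht₂, hsub⟩ := Filter.mem_prod_iff.1 ht
  refine ⟨t₁ ∩ t₂, Filter.inter_mem ht₁ ht₂, ?_⟩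
  set s := (t₁ ∩ t₂) ∩ {x | g x = 0}
  have hanti : AntilipschitzWith 2 (fun y : s => P y) := by
    refine AntilipschitzWith.of_le_mul_dist fun y z => ?_
    have h := hts (y.1, z.1) (hsub ⟨y.2.1.1, z.2.1.2⟩)
    have hy : g y = 0 := y.2.2
    have hz : g z = 0 := z.2.2
    simp only [hy, hz, sub_zero, zero_sub, norm_neg] at h
    rw [Subtype.dist_eq, Subtype.dist_eq, dist_eq_norm, dist_eq_norm]
    have e : (P y : E) - P z = (y.1 - z.1) - L (y.1 - z.1) • v := by
      simp only [hP, map_sub]; module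
    rw [e]
    have h1 := norm_sub_norm_le (y.1 - z.1) (L (y.1 - z.1) • v)
    rw [norm_smul] at h1
    have h2 : ‖L (y.1 - z.1)‖ * ‖v‖ ≤ ‖y.1 - z.1‖ / 2 := by
      calc ‖L (y.1 - z.1)‖ * ‖v‖ ≤ ‖L (y.1 - z.1)‖ * (‖v‖ + 1) := by gcongr; linarith
        _ ≤ (1 / (2 * (‖v‖ + 1)) * ‖y.1 - z.1‖) * (‖v‖ + 1) := by gcongr
        _ = ‖y.1 - z.1‖ / 2 := by field_simp
    push_cast
    linarith
  calc dimH s = dimH (univ : Set s) := by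
        rw [← (isometry_subtype_coe (s := s)).dimH_image, image_univ, Subtype.range_coe]
    _ ≤ dimH ((fun y : s => P y) '' univ) := hanti.le_dimH_image _
    _ ≤ dimH (univ : Set L.ker) := dimH_mono (subset_univ _)
    _ = Module.finrank ℝ L.ker := Real.dimH_univ_eq_finrank _
    _ = ((Module.finrank ℝ E - 1 : ℕ) : ℝ≥0∞) := by
        have h : (L : E →ₗ[ℝ] ℝ) ≠ 0 := fun h => hL (by ext x; exact LinearMap.congr_fun h x)
        have := Module.Dual.finrank_ker_add_one_of_ne_zero (f := (L : E →ₗ[ℝ] ℝ)) h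
        congr 1
        omega

theorem dimH_zero_fderiv_ne_zero_le {g : E → ℝ} {Ω : Set E} (hΩ : IsOpen Ω)
    (hg : ContDiffOn ℝ 1 g Ω) :
    dimH {x | x ∈ Ω ∧ g x = 0 ∧ fderiv ℝ g x ≠ 0} ≤ ((Module.finrank ℝ E - 1 : ℕ) : ℝ≥0∞) := by
  by_contra! h
  obtain ⟨x, hx, hxt⟩ := exists_mem_nhdsWithin_lt_dimH_of_lt_dimH h
  obtain ⟨t, ht, hdim⟩ := ((hg.contDiffAt (hΩ.mem_nhds hx.1)).hasStrictFDerivAt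
    one_ne_zero).exists_nhds_dimH_le hx.2.2
  refine (hxt (t ∩ {x | x ∈ Ω ∧ g x = 0 ∧ fderiv ℝ g x ≠ 0})
    (Filter.inter_mem (mem_nhdsWithin_of_mem_nhds ht) self_mem_nhdsWithin)).not_ge
    ((dimH_mono ?_).trans hdim)
  exact fun y hy => ⟨hy.1, hy.2.2.1⟩

end HausdorffDimension

theorem dimH_zero_le_of_iterate_lap_ne_zero {n : ℕ} {Ω : Set (EuclideanSpace ℝ (Fin n))}
    (hΩ : IsOpen Ω) {f : EuclideanSpace ℝ (Fin n) → ℝ} (hf : ContDiffOn ℝ (⊤ : ℕ∞) f Ω)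
    (h : ∀ x ∈ Ω, ∃ k, lap^[k] f x ≠ 0) :
    dimH {x | x ∈ Ω ∧ f x = 0} ≤ ((n - 1 : ℕ) : ℝ≥0∞) := by
  have hsub : {x | x ∈ Ω ∧ f x = 0} ⊆ ⋃ l : List (Fin n), {x | x ∈ Ω ∧
      iterPartialDeriv l f x = 0 ∧ fderiv ℝ (iterPartialDeriv l f) x ≠ 0} := by
    rintro x ⟨hx, hfx⟩
    obtain ⟨k, hk⟩ := h x hx
    obtain ⟨l, hl⟩ : ∃ l, iterPartialDeriv l f x ≠ 0 := by
      by_contra! h0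
      exact hk (iterate_lap_eq_zero_of_flat hΩ hx k hf h0)
    obtain ⟨l', h1, h2⟩ := exists_iterPartialDeriv_eq_zero_fderiv_ne_zero hfx hl
    exact mem_iUnion.2 ⟨l', hx, h1, h2⟩
  refine (dimH_mono hsub).trans ?_
  rw [dimH_iUnion]
  refine iSup_le fun l => ?_
  simpa using dimH_zero_fderiv_ne_zero_le hΩ ((hf.iterPartialDeriv hΩ l).of_le (by simp))

section Averages

variable {n : ℕ}

/-- The radial weight `(1 - ‖y‖²)₊ ^ k`. -/
noncomputable def ballWeight (k : ℕ) (y : EuclideanSpace ℝ (Fin n)) : ℝ :=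
  max 0 (1 - ‖y‖ ^ 2) ^ k

theorem continuous_ballWeight (k : ℕ) :
    Continuous (ballWeight k : EuclideanSpace ℝ (Fin n) → ℝ) := by
  unfold ballWeight; fun_prop

theorem ballWeight_nonneg (k : ℕ) (y : EuclideanSpace ℝ (Fin n)) : 0 ≤ ballWeight k y :=
  pow_nonneg (le_max_left _ _) _

theorem ballWeight_pos (k : ℕ) {y : EuclideanSpace ℝ (Fin n)} (hy : ‖y‖ < 1) :
    0 < ballWeight k y := by
  have : 0 < 1 - ‖y‖ ^ 2 := by nlinarith [norm_nonneg y]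
  exact pow_pos (lt_max_of_lt_right this) _

theorem ballWeight_eq_zero {k : ℕ} (hk : k ≠ 0) {y : EuclideanSpace ℝ (Fin n)} (hy : 1 ≤ ‖y‖) :
    ballWeight k y = 0 := by
  have : 1 - ‖y‖ ^ 2 ≤ 0 := by nlinarith
  rw [ballWeight, max_eq_left this, zero_pow hk]

theorem hasCompactSupport_ballWeight {k : ℕ} (hk : k ≠ 0) :
    HasCompactSupport (ballWeight k : EuclideanSpace ℝ (Fin n) → ℝ) :=
  HasCompactSupport.intro (isCompact_closedBall 0 1) fun y hy =>
    ballWeight_eq_zero hk (by simpa using (not_le.1 (by simpa using hy)).le)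

theorem integrable_mul_ballWeight {k : ℕ} (hk : k ≠ 0) {f : EuclideanSpace ℝ (Fin n) → ℝ}
    (hf : Continuous f) : Integrable fun y => f y * ballWeight k y :=
  (hf.mul (continuous_ballWeight k)).integrable_of_hasCompactSupport
    (hasCompactSupport_ballWeight hk).mul_left

theorem hasDerivAt_max_zero_pow {k : ℕ} (hk : k ≠ 0) (s : ℝ) :
    HasDerivAt (fun s : ℝ => max 0 s ^ (k + 1)) ((k + 1) * max 0 s ^ k) s := by
  rcases lt_trichotomy s 0 with hs | rfl | hs
  · rw [max_eq_left hs.le, zero_pow hk, mul_zero]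
    refine (hasDerivAt_const s (0 : ℝ)).congr_of_eventuallyEq ?_
    filter_upwards [Iio_mem_nhds hs] with r hr
    rw [max_eq_left (le_of_lt hr), zero_pow k.succ_ne_zero]
  · rw [max_self, zero_pow hk, mul_zero, hasDerivAt_iff_isLittleO]
    simp only [max_self, zero_pow k.succ_ne_zero, sub_zero, smul_zero]
    have h : (fun s : ℝ => max 0 s ^ (k + 1)) =O[𝓝 0] fun s => s ^ (k + 1) := by
      refine Asymptotics.isBigO_of_le _ fun s => ?_
      rw [norm_pow, norm_pow]
      gcongr
      rw [Real.norm_eq_abs, Real.norm_eq_abs, abs_of_nonneg (le_max_left _ _)]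
      exact max_le (abs_nonneg _) (le_abs_self _)
    exact h.trans_isLittleO (Asymptotics.isLittleO_pow_id (by omega))
  · rw [max_eq_right hs.le]
    have h := hasDerivAt_pow (k + 1) s
    simp only [Nat.add_sub_cancel, Nat.cast_add, Nat.cast_one] at h
    refine h.congr_of_eventuallyEq ?_
    filter_upwards [Ioi_mem_nhds hs] with r hr
    rw [max_eq_right (le_of_lt hr)]

theorem hasFDerivAt_ballWeight {k : ℕ} (hk : k ≠ 0) (y : EuclideanSpace ℝ (Fin n)) :
    HasFDerivAt (ballWeight (k + 1)) ((-(2 * (k + 1)) * ballWeight k y) • innerSL ℝ y) y := by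
  have h := (hasDerivAt_max_zero_pow hk (1 - ‖y‖ ^ 2)).comp_hasFDerivAt y
    ((hasStrictFDerivAt_norm_sq y).hasFDerivAt.const_sub 1)
  refine h.congr_fderiv ?_
  ext z
  simp only [ballWeight, smul_apply, neg_apply,
    smul_eq_mul, nsmul_eq_mul, Nat.cast_ofNat]
  ring

/-- Weighted averages over balls of radius `t` vary with the derivative of the function. -/
theorem hasDerivAt_integral_mul_ballWeight {k : ℕ} (hk : k ≠ 0)
    {u : EuclideanSpace ℝ (Fin n) → ℝ} (hu : ContDiff ℝ 1 u)
    (x : EuclideanSpace ℝ (Fin n)) (t : ℝ) :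
    HasDerivAt (fun t : ℝ => ∫ y, u (x + t • y) * ballWeight k y)
      (∫ y, fderiv ℝ u (x + t • y) y * ballWeight k y) t := by
  have hu' : Continuous (fderiv ℝ u) := hu.continuous_fderiv one_ne_zero
  have hG : Continuous fun p : ℝ × EuclideanSpace ℝ (Fin n) => fderiv ℝ u (x + p.1 • p.2) p.2 := by
    fun_prop
  obtain ⟨C, hC⟩ := ((isCompact_closedBall t 1).prod
    (isCompact_closedBall (0 : EuclideanSpace ℝ (Fin n)) 1)).exists_bound_of_continuousOn
    hG.continuousOn
  have hcont (s : ℝ) : Continuous fun y => u (x + s • y) := hu.continuous.comp (by fun_prop)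
  have hcont' : Continuous fun y => fderiv ℝ u (x + t • y) y := by fun_prop
  refine (hasDerivAt_integral_of_dominated_loc_of_deriv_le
    (F' := fun s y => fderiv ℝ u (x + s • y) y * ballWeight k y)
    (bound := fun y => C * ballWeight k y)
    (closedBall_mem_nhds t one_pos) (.of_forall fun s => ?_)
    (integrable_mul_ballWeight hk (hcont t)) ?_ (.of_forall fun y s hs => ?_)
    (integrable_mul_ballWeight hk continuous_const) (.of_forall fun y s _ => ?_)).2
  · exact (integrable_mul_ballWeight hk (hcont s)).aestronglyMeasurable
  · exact (integrable_mul_ballWeight hk hcont').aestronglyMeasurable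
  · by_cases hy : 1 ≤ ‖y‖
    · simp [ballWeight_eq_zero hk hy]
    · rw [norm_mul, Real.norm_of_nonneg (ballWeight_nonneg k y)]
      exact mul_le_mul_of_nonneg_right
        (hC (s, y) ⟨hs, by simpa using (not_le.1 hy).le⟩) (ballWeight_nonneg k y)
  · have h1 : HasDerivAt (fun s : ℝ => x + s • y) y s := by
      simpa using ((hasDerivAt_id s).smul_const y).const_add x
    exact ((hu.differentiable one_ne_zero _).hasFDerivAt.comp_hasDerivAt s h1).mul_const _

theorem integral_fderiv_mul_ballWeight {k : ℕ} (hk : k ≠ 0)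
    {u : EuclideanSpace ℝ (Fin n) → ℝ} (hu : ContDiff ℝ (⊤ : ℕ∞) u)
    (x : EuclideanSpace ℝ (Fin n)) (t : ℝ) :
    2 * (k + 1) * ∫ y, fderiv ℝ u (x + t • y) y * ballWeight k y =
      t * ∫ y, lap u (x + t • y) * ballWeight (k + 1) y := by
  have hd (i : Fin n) : ContDiff ℝ (⊤ : ℕ∞) (partialDeriv i u) :=
    contDiffOn_univ.1 ((contDiffOn_univ.2 hu).partialDeriv isOpen_univ i)
  have hdd (i : Fin n) : Continuous (partialDeriv i (partialDeriv i u)) :=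
    (contDiffOn_univ.1 ((contDiffOn_univ.2 (hd i)).partialDeriv isOpen_univ i)).continuous
  have hshift : Continuous fun y : EuclideanSpace ℝ (Fin n) => x + t • y := by fun_prop
  have hderiv (i : Fin n) (y : EuclideanSpace ℝ (Fin n)) :
      fderiv ℝ (fun y => partialDeriv i u (x + t • y)) y (EuclideanSpace.single i 1) =
        t * partialDeriv i (partialDeriv i u) (x + t • y) := by
    have h1 : HasFDerivAt (fun y : EuclideanSpace ℝ (Fin n) => x + t • y)
        (t • ContinuousLinearMap.id ℝ _) y := ((hasFDerivAt_id y).const_smul t).const_add x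
    have h2 := (((hd i).differentiable (by simp)) (x + t • y)).hasFDerivAt.comp y h1
    rw [show (fun y => partialDeriv i u (x + t • y)) = partialDeriv i u ∘ fun y => x + t • y
      from rfl, h2.fderiv]
    simp [partialDeriv]
  have hweight (i : Fin n) (y : EuclideanSpace ℝ (Fin n)) :
      fderiv ℝ (ballWeight (k + 1)) y (EuclideanSpace.single i 1) =
        -(2 * (k + 1)) * (y i * ballWeight k y) := by
    rw [(hasFDerivAt_ballWeight hk y).fderiv]
    simp [EuclideanSpace.inner_single_right]
    ring
  have hcoord (i : Fin n) : Continuous fun y : EuclideanSpace ℝ (Fin n) => y i := by fun_prop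
  have h_int (i : Fin n) : Integrable fun y =>
      (partialDeriv i u (x + t • y) * y i) * ballWeight k y :=
    integrable_mul_ballWeight hk (((hd i).continuous.comp hshift).mul (hcoord i))
  have h_int' (i : Fin n) : Integrable fun y =>
      partialDeriv i (partialDeriv i u) (x + t • y) * ballWeight (k + 1) y :=
    integrable_mul_ballWeight k.succ_ne_zero ((hdd i).comp hshift)
  have hparts (i : Fin n) :
      2 * (k + 1) * ∫ y, (partialDeriv i u (x + t • y) * y i) * ballWeight k y =
        t * ∫ y, partialDeriv i (partialDeriv i u) (x + t • y) * ballWeight (k + 1) y := by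
    have h := integral_mul_fderiv_eq_neg_fderiv_mul_of_integrable
      (μ := (volume : Measure (EuclideanSpace ℝ (Fin n))))
      (f := fun y => partialDeriv i u (x + t • y)) (g := ballWeight (k + 1))
      (v := EuclideanSpace.single i 1) ?_ ?_ ?_ ?_ ?_
    · simp only [hderiv, hweight] at h
      rw [← integral_const_mul, ← integral_const_mul]
      simp only [mul_assoc t] at h
      rw [← neg_inj, ← h, ← integral_neg]
      congr 1 with y
      ring
    · simp only [hderiv, mul_assoc t]
      exact (h_int' i).const_mul t
    · simp only [hweight]
      convert (h_int i).const_mul (-(2 * ((k : ℝ) + 1))) using 2 with y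
      ring
    · exact integrable_mul_ballWeight k.succ_ne_zero ((hd i).continuous.comp hshift)
    · exact fun y _ => (((hd i).differentiable (by simp)) _).comp y (by fun_prop)
    · exact fun y _ => (hasFDerivAt_ballWeight hk y).differentiableAt
  have hL (y : EuclideanSpace ℝ (Fin n)) : fderiv ℝ u (x + t • y) y * ballWeight k y =
      ∑ i, (partialDeriv i u (x + t • y) * y i) * ballWeight k y := by
    rw [← Finset.sum_mul]
    congr 1
    have h := congrArg (fderiv ℝ u (x + t • y)) ((EuclideanSpace.basisFun (Fin n) ℝ).sum_repr y)
    simp only [map_sum, map_smul, EuclideanSpace.basisFun_repr, EuclideanSpace.basisFun_apply,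
      smul_eq_mul] at h
    simp only [← h, partialDeriv, mul_comm]
  simp only [hL, lap_eq_sum_partialDeriv, Finset.sum_mul]
  rw [integral_finsetSum _ fun i _ => h_int i, integral_finsetSum _ fun i _ => h_int' i,
    Finset.mul_sum, Finset.mul_sum]
  exact Finset.sum_congr rfl fun i _ => hparts i

theorem integral_mul_ballWeight_eq_zero {m : ℕ} {u : EuclideanSpace ℝ (Fin n) → ℝ}
    (hu : ContDiff ℝ (⊤ : ℕ∞) u) {x : EuclideanSpace ℝ (Fin n)} {R : ℝ}
    (hlap : ∀ y ∈ ball x R, lap^[m] u y = 0) (hx : ∀ k < m, lap^[k] u x = 0)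
    {k : ℕ} (hk : k ≠ 0) {t : ℝ} (ht : t ∈ Ico 0 R) :
    ∫ y, u (x + t • y) * ballWeight k y = 0 := by
  induction m generalizing u k t with
  | zero =>
    refine integral_eq_zero_of_ae (.of_forall fun y => ?_)
    by_cases hy : 1 ≤ ‖y‖
    · simp [ballWeight_eq_zero hk hy]
    · have : u (x + t • y) = 0 := hlap _ (by
        rw [mem_ball, dist_eq_norm, add_sub_cancel_left, norm_smul, Real.norm_of_nonneg ht.1]
        nlinarith [ht.1, ht.2, norm_nonneg y])
      simp [this]
  | succ m ih =>
    have hlu : ContDiff ℝ (⊤ : ℕ∞) (lap u) :=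
      contDiffOn_univ.1 ((contDiffOn_univ.2 hu).lap isOpen_univ)
    have hder (s : ℝ) (hs : s ∈ Ico 0 t) :
        HasDerivWithinAt (fun t : ℝ => ∫ y, u (x + t • y) * ballWeight k y) 0 (Ici s) s := by
      have h := hasDerivAt_integral_mul_ballWeight hk (hu.of_le (by simp)) x s
      have h0 := integral_fderiv_mul_ballWeight hk hu x s
      rw [ih hlu hlap (fun j hj => hx (j + 1) (by omega)) k.succ_ne_zero
        ⟨hs.1, hs.2.trans ht.2⟩, mul_zero] at h0
      rw [(mul_eq_zero.1 h0).resolve_left (by positivity)] at h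
      exact h.hasDerivWithinAt
    have h := constant_of_has_deriv_right_zero (a := 0) (b := t) (fun s _ =>
      (hasDerivAt_integral_mul_ballWeight hk (hu.of_le (by simp)) x
        s).continuousAt.continuousWithinAt) hder t ⟨ht.1, le_rfl⟩
    have hux : u x = 0 := hx 0 (by omega)
    simpa [hux] using h

theorem eqOn_zero_of_nonpos_of_iterate_lap_eq_zero {m : ℕ} {u : EuclideanSpace ℝ (Fin n) → ℝ}
    (hu : ContDiff ℝ (⊤ : ℕ∞) u) {x : EuclideanSpace ℝ (Fin n)} {R : ℝ}
    (hlap : ∀ y ∈ ball x R, lap^[m] u y = 0) (hx : ∀ k < m, lap^[k] u x = 0)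
    (hneg : ∀ y ∈ ball x R, u y ≤ 0) : EqOn u 0 (ball x R) := by
  intro z hz
  obtain ⟨t, ht, htR⟩ := exists_between (mem_ball_iff_norm.1 hz)
  have ht0 : 0 < t := (norm_nonneg _).trans_lt ht
  have h_int := integral_mul_ballWeight_eq_zero hu hlap hx one_ne_zero ⟨ht0.le, htR⟩
  have hcont : Continuous fun y => u (x + t • y) := hu.continuous.comp (by fun_prop)
  have hnonpos : (fun y => u (x + t • y) * ballWeight 1 y) ≤ 0 := fun y => by
    by_cases hy : 1 ≤ ‖y‖
    · simp [ballWeight_eq_zero one_ne_zero hy]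
    · refine mul_nonpos_of_nonpos_of_nonneg (hneg _ ?_) (ballWeight_nonneg 1 y)
      rw [mem_ball, dist_eq_norm, add_sub_cancel_left, norm_smul, Real.norm_of_nonneg ht0.le]
      nlinarith [norm_nonneg y]
  have hae := (integral_eq_zero_iff_of_nonneg (f := fun y => -(u (x + t • y) * ballWeight 1 y))
    (fun y => neg_nonneg.2 (hnonpos y)) (integrable_mul_ballWeight one_ne_zero hcont).neg).1
    (by rw [integral_neg, h_int, neg_zero])
  have heq := (Continuous.ae_eq_iff_eq volume ((hcont.mul (continuous_ballWeight 1)).neg)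
    continuous_const).1 hae
  have h : -(u (x + t • t⁻¹ • (z - x)) * ballWeight 1 (t⁻¹ • (z - x))) = 0 :=
    congrFun heq (t⁻¹ • (z - x))
  have hlt : ‖t⁻¹ • (z - x)‖ < 1 := by
    rw [norm_smul, norm_inv, Real.norm_of_nonneg ht0.le, inv_mul_lt_one₀ ht0]
    exact ht
  simpa [smul_smul, ht0.ne', (ballWeight_pos 1 hlt).ne'] using h

end Averages

theorem exists_contDiff_eqOn_ball {E : Type*} [NormedAddCommGroup E] [InnerProductSpace ℝ E]
    [FiniteDimensional ℝ E] {Ω : Set E} (hΩ : IsOpen Ω) {f : E → ℝ}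
    (hf : ContDiffOn ℝ (⊤ : ℕ∞) f Ω) {x : E} (hx : x ∈ Ω) :
    ∃ R > 0, ball x R ⊆ Ω ∧ ∃ u : E → ℝ, ContDiff ℝ (⊤ : ℕ∞) u ∧ EqOn u f (ball x R) := by
  obtain ⟨ε, hε, hεΩ⟩ := nhds_basis_closedBall.mem_iff.1 (hΩ.mem_nhds hx)
  let χ : ContDiffBump x := ⟨ε / 2, ε, by positivity, by linarith⟩
  refine ⟨ε / 2, by positivity, fun y hy => hεΩ ?_, fun y => χ y * f y,
    contDiff_iff_contDiffAt.2 fun y => ?_, fun y hy => ?_⟩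
  · exact closedBall_subset_closedBall (by linarith) (ball_subset_closedBall hy)
  · by_cases hy : y ∈ closedBall x ε
    · exact χ.contDiff.contDiffAt.mul (hf.contDiffAt (hΩ.mem_nhds (hεΩ hy)))
    · have h : χ =ᶠ[𝓝 y] 0 := notMem_tsupport_iff_eventuallyEq.1 (by rwa [χ.tsupport_eq])
      refine (contDiffAt_const (c := (0 : ℝ))).congr_of_eventuallyEq ?_
      filter_upwards [h] with z hz
      simp [hz]
  · simp [χ.one_of_mem_closedBall (ball_subset_closedBall hy)]

/-- A nonpositive polyharmonic function all of whose iterated Laplacians vanish at a point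
vanishes near that point. -/
theorem exists_eqOn_zero_ball_of_iterate_lap_eq_zero {n m : ℕ}
    {Ω : Set (EuclideanSpace ℝ (Fin n))} (hΩ : IsOpen Ω) {f : EuclideanSpace ℝ (Fin n) → ℝ}
    (hf : ContDiffOn ℝ (⊤ : ℕ∞) f Ω) (hlap : ∀ x ∈ Ω, lap^[m] f x = 0)
    (hneg : ∀ x ∈ Ω, f x ≤ 0) {x : EuclideanSpace ℝ (Fin n)} (hx : x ∈ Ω)
    (hfx : ∀ k < m, lap^[k] f x = 0) :
    ∃ R > 0, ball x R ⊆ Ω ∧ EqOn f 0 (ball x R) := by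
  obtain ⟨R, hR, hRΩ, u, hu, huf⟩ := exists_contDiff_eqOn_ball hΩ hf hx
  refine ⟨R, hR, hRΩ, huf.symm.trans (eqOn_zero_of_nonpos_of_iterate_lap_eq_zero (m := m) hu
    (fun y hy => ?_) (fun k hk => ?_) fun y hy => ?_)⟩
  · rw [huf.iterate_lap isOpen_ball m hy, hlap y (hRΩ hy)]
  · rw [huf.iterate_lap isOpen_ball k (mem_ball_self hR), hfx k hk]
  · rw [huf hy]
    exact hneg y (hRΩ hy)

theorem exists_iterate_lap_ne_zero {n m : ℕ}
    {Ω : Set (EuclideanSpace ℝ (Fin n))} (hΩ : IsOpen Ω) (hΩc : IsPreconnected Ω)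
    {f : EuclideanSpace ℝ (Fin n) → ℝ}
    (hf : ContDiffOn ℝ (⊤ : ℕ∞) f Ω) (hlap : ∀ x ∈ Ω, lap^[m] f x = 0)
    (hneg : ∀ x ∈ Ω, f x ≤ 0) (hnz : ∃ x ∈ Ω, f x ≠ 0) :
    ∀ x ∈ Ω, ∃ k, lap^[k] f x ≠ 0 := by
  by_contra! h
  obtain ⟨a, ha, haf⟩ := h
  obtain ⟨b, hb, hbf⟩ := hnz
  set Z := {x | ∃ R > 0, EqOn f 0 (ball x R)}
  have hmem {x} (hx : x ∈ Ω) (hfx : ∀ k, lap^[k] f x = 0) : x ∈ Z :=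
    let ⟨R, hR, _, h⟩ := exists_eqOn_zero_ball_of_iterate_lap_eq_zero hΩ hf hlap hneg hx
      fun k _ => hfx k
    ⟨R, hR, h⟩
  have hZo : IsOpen Z := by
    refine Metric.isOpen_iff.2 fun x ⟨R, hR, h⟩ => ⟨R, hR, fun y hy => ?_⟩
    obtain ⟨r, hr, hrR⟩ := Metric.isOpen_iff.1 isOpen_ball y hy
    exact ⟨r, hr, h.mono hrR⟩
  set W := {x | x ∈ Ω ∧ ∃ k, lap^[k] f x ≠ 0} with hW
  have hWo : IsOpen W := by
    have : W = ⋃ k, Ω ∩ (lap^[k] f) ⁻¹' {0}ᶜ := by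
      ext x; simp [hW]
    rw [this]
    exact isOpen_iUnion fun k => (hf.iterate_lap hΩ k).continuousOn.isOpen_inter_preimage hΩ
      isOpen_compl_singleton
  obtain ⟨x, hx, ⟨R, hR, hxR⟩, -, k, hk⟩ := hΩc Z W hZo hWo
    (fun x hx => by
      by_cases h : ∃ k, lap^[k] f x ≠ 0
      · exact Or.inr ⟨hx, h⟩
      · exact Or.inl (hmem hx (by simpa using h)))
    ⟨a, ha, hmem ha haf⟩ ⟨b, hb, hb, 0, hbf⟩
  refine hk ?_
  rw [hxR.iterate_lap isOpen_ball k (mem_ball_self hR)]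
  refine iterate_lap_eq_zero_of_flat isOpen_univ (mem_univ x) k contDiffOn_const fun l => ?_
  induction l with
  | nil => rfl
  | cons i l ih =>
    have h0 : partialDeriv i (0 : EuclideanSpace ℝ (Fin n) → ℝ) = 0 := by
      funext y; simp [partialDeriv]
    rw [iterPartialDeriv, h0, ih]

theorem isNowhereDense_of_interior_eq_empty_of_closure_inter_subset {X : Type*}
    [TopologicalSpace X] {S Ω : Set X} (hΩ : IsOpen Ω) (hS : S ⊆ Ω) (hcl : closure S ∩ Ω ⊆ S)
    (h_int : interior S = ∅) : IsNowhereDense S := by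
  rw [IsNowhereDense, eq_empty_iff_forall_notMem]
  intro x hx
  obtain ⟨y, hy, hyS⟩ := mem_closure_iff.1 (interior_subset hx) _ isOpen_interior hx
  have : y ∈ interior S := mem_interior.2 ⟨interior (closure S) ∩ Ω,
    fun z hz => hcl ⟨interior_subset hz.1, hz.2⟩, isOpen_interior.inter hΩ, hy, hS hyS⟩
  simp [h_int] at this

theorem stmt_13 (m : ℕ) (hm : 1 < m)
    (Ω : Set (EuclideanSpace ℝ (Fin (2*m)))) (hΩo : IsOpen Ω) (hΩc : IsConnected Ω)
    (φ : EuclideanSpace ℝ (Fin (2*m)) → ℝ)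
    (hsm : ContDiffOn ℝ (⊤ : ℕ∞) φ Ω)
    (hph : ∀ x ∈ Ω, lap^[m] φ x = 0)
    (hneg : ∀ x ∈ Ω, φ x ≤ 0)
    (hnz : ∃ x ∈ Ω, φ x ≠ 0) :
    (closure {x | x ∈ Ω ∧ φ x = 0} ∩ Ω ⊆ {x | x ∈ Ω ∧ φ x = 0}) ∧
    IsNowhereDense {x | x ∈ Ω ∧ φ x = 0} ∧
    dimH {x | x ∈ Ω ∧ φ x = 0} ≤ ((2*m-1 : ℕ) : ℝ≥0∞) := by
  have hdim := dimH_zero_le_of_iterate_lap_ne_zero hΩo hsm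
    (exists_iterate_lap_ne_zero hΩo hΩc.isPreconnected hsm hph hneg hnz)
  have hcl : closure {x | x ∈ Ω ∧ φ x = 0} ∩ Ω ⊆ {x | x ∈ Ω ∧ φ x = 0} := by
    rintro x ⟨hx, hxΩ⟩
    refine ⟨hxΩ, by_contra fun hne => ?_⟩
    obtain ⟨y, hy, hyΩ, hy0⟩ := mem_closure_iff.1 hx _
      (hsm.continuousOn.isOpen_inter_preimage hΩo isOpen_compl_singleton) ⟨hxΩ, hne⟩
    exact hy.2 hy0
  refine ⟨hcl, isNowhereDense_of_interior_eq_empty_of_closure_inter_subset hΩo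
    (fun x hx => hx.1) hcl ?_, hdim⟩
  by_contra hne
  rw [Real.dimH_of_nonempty_interior (nonempty_iff_ne_empty.2 hne), finrank_euclideanSpace_fin,
    Nat.cast_le] at hdim
  omega
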